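/- arXiv:1301.1797 — 8 statements merged into one kernel-verified Lean document; each statement's English description precedes it below -/
import Mathlib

section
/- Let (λ_n)_{n≥0}, (γ_n)_{n≥0} be sequences with λ_0>0, γ_0=0, γ_n>0 and λ_n≥0 for n≥1, let b∈(0,1), and define (p_n)_{n≥0} by p_0>0 and p_{n+1} = p_n (λ_n + b γ_n)/γ_{n+1} for n≥0. If limsup_{n→∞} λ_n/γ_n < 1−b and liminf_{n→∞} γ_n > 0, then ∑_{n=0}^∞ p_n < ∞ and ∑_{n=0}^∞ (λ_n + γ_n) p_n < ∞. -/
open Filter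

theorem stmt4 (lam gam : ℕ → ℝ) (b : ℝ) (p : ℕ → ℝ)
    (hb0 : 0 < b) (hb1 : b < 1)
    (hlam0 : 0 < lam 0) (hgam0 : gam 0 = 0)
    (hgam : ∀ n, 1 ≤ n → 0 < gam n) (hlam : ∀ n, 1 ≤ n → 0 ≤ lam n)
    (hp0 : 0 < p 0)
    (hrec : ∀ n : ℕ, p (n + 1) = p n * (lam n + b * gam n) / gam (n + 1))
    (hlimsup : limsup (fun n : ℕ => ((lam n / gam n : ℝ) : EReal)) atTop
        < ((1 - b : ℝ) : EReal))
    (hliminf : (0 : EReal) < liminf (fun n : ℕ => ((gam n : ℝ) : EReal)) atTop) :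
    Summable p ∧ Summable (fun n : ℕ => (lam n + gam n) * p n) := by
  obtain ⟨r, hr1, hr2⟩ := EReal.lt_iff_exists_real_btwn.1 hlimsup
  obtain ⟨c, hc1, hc2⟩ := EReal.lt_iff_exists_real_btwn.1 hliminf
  have hr : r < 1 - b := by exact_mod_cast hr2
  have hc : 0 < c := by exact_mod_cast hc1
  have h1 : ∀ᶠ n in atTop, lam n / gam n < r := by
    filter_upwards [eventually_lt_of_limsup_lt hr1] with n hn
    exact_mod_cast hn
  have h2 : ∀ᶠ n in atTop, c < gam n := by
    filter_upwards [eventually_lt_of_lt_liminf hc2] with n hn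
    exact_mod_cast hn
  have hp : ∀ n, 0 < p n := by
    intro n
    induction n with
    | zero => exact hp0
    | succ k ih =>
      rw [hrec]
      refine div_pos (mul_pos ih ?_) (hgam _ (by omega))
      rcases Nat.eq_zero_or_pos k with h | h
      · subst h
        rw [hgam0]
        linarith
      · have := hlam k h
        have := mul_pos hb0 (hgam k h)
        linarith
  have hq : Summable (fun n => gam n * p n) := by
    refine summable_of_ratio_norm_eventually_le (r := r + b) (by linarith) ?_
    filter_upwards [h1, eventually_ge_atTop 1] with n hn hn1
    have hg := hgam n hn1
    have hg' := hgam (n + 1) (by omega)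
    rw [Real.norm_of_nonneg (mul_pos hg' (hp _)).le, Real.norm_of_nonneg (mul_pos hg (hp _)).le,
      hrec, mul_div_cancel₀ _ hg'.ne']
    rw [div_lt_iff₀ hg] at hn
    have := mul_lt_mul_of_pos_right hn (hp n)
    nlinarith
  constructor
  · refine (hq.mul_left c⁻¹).of_norm_bounded_eventually_nat ?_
    filter_upwards [h2] with n hn
    rw [Real.norm_of_nonneg (hp n).le, inv_mul_eq_div, le_div_iff₀ hc]
    nlinarith [hp n]
  · refine (hq.mul_left 2).of_norm_bounded_eventually_nat ?_
    filter_upwards [h1, eventually_ge_atTop 1] with n hn hn1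
    have hg := hgam n hn1
    have hl := hlam n hn1
    rw [div_lt_iff₀ hg] at hn
    rw [Real.norm_of_nonneg (mul_nonneg (by linarith) (hp n).le)]
    have : lam n ≤ gam n := by nlinarith
    have := mul_le_mul_of_nonneg_right this (hp n).le
    linarith
end

section
/- Let γ>0, λ_0>0, b∈(0,1), and set λ_n = 0 for n≥1, γ_n = γn. Define p*_0 = bγ/(bγ − λ_0 ln(1−b)) and p*_n = −(b^n/(n ln(1−b)))·(1−p*_0) for n≥1. Then p*_0 ∈ (0,1), ∑_{n=0}^∞ p*_n = 1, and (p*_n)_{n≥0} satisfies the recursion p*_{n+1}/p*_n = (λ_n + bγ_n)/γ_{n+1} for all n≥0; equivalently p*_n = p*_0 (λ_0/γ) b^{n−1}/n for n≥1. -/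
/-- Production rates: `λ_0 = lam0` and `λ_n = 0` for `n ≥ 1`. -/
noncomputable def lamSeq (lam0 : ℝ) (n : ℕ) : ℝ := if n = 0 then lam0 else 0

/-- The stationary distribution: a mixture of the point mass at `0`
and a logarithmic distribution. -/
noncomputable def pLog (γ lam0 b : ℝ) (n : ℕ) : ℝ :=
  if n = 0 then b * γ / (b * γ - lam0 * Real.log (1 - b))
  else -(b ^ n / (n * Real.log (1 - b)))
    * (1 - b * γ / (b * γ - lam0 * Real.log (1 - b)))

theorem pLog_succ_aux (γ lam0 b : ℝ) (hL : Real.log (1 - b) ≠ 0)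
    (hD : b * γ - lam0 * Real.log (1 - b) ≠ 0) (n : ℕ) :
    pLog γ lam0 b (n + 1)
      = lam0 / (b * γ - lam0 * Real.log (1 - b)) * (b ^ (n + 1) / ((n : ℝ) + 1)) := by
  have hn : (n : ℝ) + 1 ≠ 0 := by positivity
  unfold pLog
  rw [if_neg (Nat.succ_ne_zero n)]
  push_cast
  generalize Real.log (1 - b) = L at *
  have h1 : 1 - b * γ / (b * γ - lam0 * L) = -(lam0 * L) / (b * γ - lam0 * L) := by
    rw [eq_div_iff hD, sub_mul, div_mul_cancel₀ _ hD]
    ring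
  rw [h1]
  generalize b * γ - lam0 * L = D at *
  field_simp

theorem stmt6 (γ lam0 b : ℝ) (hγ : 0 < γ) (hlam0 : 0 < lam0)
    (hb0 : 0 < b) (hb1 : b < 1) :
    (0 < pLog γ lam0 b 0 ∧ pLog γ lam0 b 0 < 1) ∧
    HasSum (pLog γ lam0 b) 1 ∧
    (∀ n : ℕ, pLog γ lam0 b (n + 1) / pLog γ lam0 b n
      = (lamSeq lam0 n + b * (γ * n)) / (γ * (n + 1))) ∧
    (∀ n : ℕ, 1 ≤ n → pLog γ lam0 b n
      = pLog γ lam0 b 0 * (lam0 / γ) * b ^ (n - 1) / n) := by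
  have hL : Real.log (1 - b) < 0 := Real.log_neg (by linarith) (by linarith)
  have hbg : 0 < b * γ := mul_pos hb0 hγ
  have hlL : lam0 * Real.log (1 - b) < 0 := mul_neg_of_pos_of_neg hlam0 hL
  have hD : 0 < b * γ - lam0 * Real.log (1 - b) := by linarith
  have hs := pLog_succ_aux γ lam0 b hL.ne hD.ne'
  have h0 : pLog γ lam0 b 0 = b * γ / (b * γ - lam0 * Real.log (1 - b)) := by simp [pLog]
  refine ⟨⟨?_, ?_⟩, ?_, ?_, ?_⟩
  · rw [h0]; positivity
  · rw [h0, div_lt_one hD]; linarith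
  · have hsum := (Real.hasSum_pow_div_log_of_abs_lt_one (x := b)
      (by rw [abs_of_pos hb0]; exact hb1)).mul_left
        (lam0 / (b * γ - lam0 * Real.log (1 - b)))
    rw [← hasSum_nat_add_iff' 1]
    simp only [hs, Finset.sum_range_one, h0]
    have he : 1 - b * γ / (b * γ - lam0 * Real.log (1 - b))
        = lam0 / (b * γ - lam0 * Real.log (1 - b)) * -Real.log (1 - b) := by
      rw [div_mul_eq_mul_div, eq_div_iff hD.ne', sub_mul, div_mul_cancel₀ _ hD.ne']
      ring
    rw [he]
    exact hsum
  · intro n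
    rcases n with _ | n
    · rw [hs, h0]
      simp only [lamSeq]
      generalize b * γ - lam0 * Real.log (1 - b) = D at *
      have := hD.ne'
      simp
      field_simp
    · rw [hs, hs]
      simp only [lamSeq]
      generalize b * γ - lam0 * Real.log (1 - b) = D at *
      have := hD.ne'
      have h1 : (n : ℝ) + 1 ≠ 0 := by positivity
      have h2 : (n : ℝ) + 1 + 1 ≠ 0 := by positivity
      rw [if_neg (Nat.succ_ne_zero n)]
      push_cast
      field_simp
      ring
  · intro n hn
    obtain ⟨m, rfl⟩ : ∃ m, n = m + 1 := ⟨n - 1, by omega⟩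
    rw [hs, h0, Nat.add_sub_cancel]
    generalize b * γ - lam0 * Real.log (1 - b) = D at *
    have := hD.ne'
    have h1 : (m : ℝ) + 1 ≠ 0 := by positivity
    push_cast
    field_simp
    ring
end

section
/- Let λ>0, Λ≥1, Δ>0, Θ≥Δ, γ>0, b∈(0,1), and set λ_n = λ(1+Θn)/(Λ+Δn) and γ_n = γn for n≥0. Define b_1 = Λ/Δ, α = Λ/Δ + λΘ/(bγΔ), β = √(α² − 4λ/(bγΔ)), a_1 = (α−β)/2, a_2 = (α+β)/2. Then: (i) α² − 4λ/(bγΔ) ≥ 0 so β is a well-defined nonnegative real and a_2 ≥ a_1 > 0; (ii) for every n≥0, (λ_n + bγn)/γ = b(n+a_1)(n+a_2)/(n+b_1); (iii) the sequence p*_n = C · ((a_1)_n (a_2)_n / (b_1)_n) · b^n/n!, with normalizing constant C = (∑_{m=0}^∞ ((a_1)_m (a_2)_m / (b_1)_m) b^m/m!)^{-1}, is summable with sum 1 and satisfies p*_{n+1}/p*_n = (λ_n + bγ_n)/γ_{n+1} for all n≥0. -/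
open scoped BigOperators

/-- General term of Gauss' hypergeometric series:
`((a₁)_n (a₂)_n / (b₁)_n) · bⁿ/n!`, with `(a)_n` the Pochhammer symbol. -/
noncomputable def hypTerm (a1 a2 b1 b : ℝ) (n : ℕ) : ℝ :=
  (ascPochhammer ℝ n).eval a1 * (ascPochhammer ℝ n).eval a2
    / (ascPochhammer ℝ n).eval b1 * b ^ n / (n.factorial : ℝ)

lemma hypTerm_succ' (a1 a2 b1 b : ℝ) (h3 : 0 < b1) (n : ℕ) :
    hypTerm a1 a2 b1 b (n + 1)
      = hypTerm a1 a2 b1 b n * (b * (n + a1) * (n + a2) / (n + b1) / (n + 1)) := by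
  have hp : (ascPochhammer ℝ n).eval b1 ≠ 0 := (ascPochhammer_pos n b1 h3).ne'
  have hq : (n : ℝ) + b1 ≠ 0 := by positivity
  have hq' : b1 + (n : ℝ) ≠ 0 := by positivity
  have hf : (n.factorial : ℝ) ≠ 0 := by positivity
  have hn : (n : ℝ) + 1 ≠ 0 := by positivity
  unfold hypTerm
  rw [ascPochhammer_succ_eval, ascPochhammer_succ_eval, ascPochhammer_succ_eval,
    Nat.factorial_succ]
  push_cast
  field_simp
  ring

lemma hypTerm_pos' (a1 a2 b1 b : ℝ) (h1 : 0 < a1) (h2 : 0 < a2) (h3 : 0 < b1) (hb : 0 < b)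
    (n : ℕ) : 0 < hypTerm a1 a2 b1 b n := by
  have := ascPochhammer_pos n a1 h1
  have := ascPochhammer_pos n a2 h2
  have := ascPochhammer_pos n b1 h3
  unfold hypTerm
  positivity

lemma tendsto_aux' (x y : ℝ) :
    Filter.Tendsto (fun n : ℕ => ((n : ℝ) + x) / (n + y)) Filter.atTop (nhds 1) := by
  have hy : Filter.Tendsto (fun n : ℕ => (n : ℝ) + y) Filter.atTop Filter.atTop :=
    Filter.tendsto_atTop_add_const_right _ _ tendsto_natCast_atTop_atTop
  have h : Filter.Tendsto (fun n : ℕ => 1 + (x - y) / ((n : ℝ) + y)) Filter.atTop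
      (nhds (1 + 0)) := (hy.const_div_atTop (x - y)).const_add 1
  rw [add_zero] at h
  refine h.congr' ?_
  filter_upwards [hy.eventually_gt_atTop 0] with n hn
  field_simp
  ring

lemma hypTerm_summable' (a1 a2 b1 b : ℝ) (h1 : 0 < a1) (h2 : 0 < a2) (h3 : 0 < b1)
    (hb : 0 < b) (hb1 : b < 1) : Summable (hypTerm a1 a2 b1 b) := by
  refine summable_of_ratio_test_tendsto_lt_one hb1
    (Filter.Eventually.of_forall fun n => (hypTerm_pos' a1 a2 b1 b h1 h2 h3 hb n).ne') ?_
  have h := ((tendsto_aux' a1 b1).mul (tendsto_aux' a2 1)).const_mul b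
  simp only [mul_one] at h
  refine h.congr fun n => ?_
  have hp := hypTerm_pos' a1 a2 b1 b h1 h2 h3 hb n
  rw [Real.norm_of_nonneg (hypTerm_pos' a1 a2 b1 b h1 h2 h3 hb (n + 1)).le,
    Real.norm_of_nonneg hp.le, hypTerm_succ' a1 a2 b1 b h3, mul_div_cancel_left₀ _ hp.ne']
  field_simp

theorem stmt7 (lam Lam Del Th γ b : ℝ)
    (hlam : 0 < lam) (hLam : 1 ≤ Lam) (hDel : 0 < Del) (hTh : Del ≤ Th)
    (hγ : 0 < γ) (hb0 : 0 < b) (hb1 : b < 1)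
    (b1 α β a1 a2 : ℝ)
    (hb1def : b1 = Lam / Del)
    (hα : α = Lam / Del + lam * Th / (b * γ * Del))
    (hβ : β = Real.sqrt (α ^ 2 - 4 * lam / (b * γ * Del)))
    (ha1 : a1 = (α - β) / 2) (ha2 : a2 = (α + β) / 2) :
    (0 ≤ α ^ 2 - 4 * lam / (b * γ * Del) ∧ 0 < a1 ∧ a1 ≤ a2) ∧
    (∀ n : ℕ, (lam * (1 + Th * n) / (Lam + Del * n) + b * (γ * n)) / γ
      = b * (n + a1) * (n + a2) / (n + b1)) ∧
    (HasSum (fun n : ℕ =>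
        (∑' m : ℕ, hypTerm a1 a2 b1 b m)⁻¹ * hypTerm a1 a2 b1 b n) 1 ∧
      ∀ n : ℕ,
        ((∑' m : ℕ, hypTerm a1 a2 b1 b m)⁻¹ * hypTerm a1 a2 b1 b (n + 1))
          / ((∑' m : ℕ, hypTerm a1 a2 b1 b m)⁻¹ * hypTerm a1 a2 b1 b n)
        = (lam * (1 + Th * n) / (Lam + Del * n) + b * (γ * n)) / (γ * (n + 1))) := by
  have hL : 0 < Lam := by linarith
  have hT : 0 < Th := by linarith
  have hb1p : 0 < b1 := by rw [hb1def]; positivity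
  have hαp : 0 < α := by rw [hα]; positivity
  obtain ⟨k, hk⟩ : ∃ k, k = lam / (b * γ) := ⟨_, rfl⟩
  have hkp : 0 < k := by rw [hk]; positivity
  have hlk : lam = k * (b * γ) := by rw [hk]; field_simp
  have e1 : 4 * lam / (b * γ * Del) = 4 * (k / Del) := by rw [hlk]; field_simp
  have e2 : α = (Lam + k * Th) / Del := by rw [hα, hlk]; field_simp
  have hkD : 0 < k / Del := by positivity
  have hdisc : 0 ≤ α ^ 2 - 4 * (k / Del) := by
    have : α ^ 2 - 4 * (k / Del) = ((Lam + k * Th) ^ 2 - 4 * k * Del) / Del ^ 2 := by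
      rw [e2]; field_simp
    rw [this]
    apply div_nonneg _ (by positivity)
    have : Del ≤ Lam * Th := by nlinarith
    nlinarith [sq_nonneg (Lam - k * Th), mul_le_mul_of_nonneg_left this hkp.le]
  rw [e1] at hβ
  have hβ0 : 0 ≤ β := by rw [hβ]; positivity
  have hβ2 : β ^ 2 = α ^ 2 - 4 * (k / Del) := by rw [hβ, Real.sq_sqrt hdisc]
  have hβα : β < α := by nlinarith
  have h1 : 0 < a1 := by rw [ha1]; linarith
  have h12 : a1 ≤ a2 := by rw [ha1, ha2]; linarith
  have h2 : 0 < a2 := by linarith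
  have hs : a1 + a2 = α := by rw [ha1, ha2]; ring
  have hm : a1 * a2 = k / Del := by rw [ha1, ha2]; linear_combination (-1 / 4) * hβ2
  have key : ∀ n : ℕ, (lam * (1 + Th * n) / (Lam + Del * n) + b * (γ * n)) / γ
      = b * (n + a1) * (n + a2) / (n + b1) := by
    intro n
    have e : b * ((n : ℝ) + a1) * (n + a2) = b * (n ^ 2 + α * n + k / Del) := by
      rw [← hs, ← hm]; ring
    have hd : Lam + Del * (n : ℝ) ≠ 0 := by positivity
    have hd2 : (n : ℝ) + b1 = (Lam + Del * n) / Del := by rw [hb1def]; field_simp; ring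
    rw [e, hd2, e2, hlk]
    field_simp
    ring
  have hsum := hypTerm_summable' a1 a2 b1 b h1 h2 hb1p hb0 hb1
  have hpos := hypTerm_pos' a1 a2 b1 b h1 h2 hb1p hb0
  have hS : 0 < ∑' m : ℕ, hypTerm a1 a2 b1 b m :=
    hsum.tsum_pos (fun n => (hpos n).le) 0 (hpos 0)
  refine ⟨⟨by rw [e1]; exact hdisc, h1, h12⟩, key, ?_, ?_⟩
  · have := hsum.hasSum.mul_left (∑' m : ℕ, hypTerm a1 a2 b1 b m)⁻¹
    rwa [inv_mul_cancel₀ hS.ne'] at this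
  · intro n
    rw [mul_div_mul_left _ _ (inv_ne_zero hS.ne'), hypTerm_succ' a1 a2 b1 b hb1p,
      mul_div_cancel_left₀ _ (hpos n).ne', ← key n, div_div]
end

section
/- Let R be a positive (i.e. order-preserving: v ≥ 0 implies Rv ≥ 0) bounded linear operator on L¹((0,∞)) with ‖Rv‖₁ ≤ ‖v‖₁ for all v ≥ 0, and suppose that for every nonnegative v ∈ L¹((0,∞)) that is not a.e. zero there exists c(v) > 0 such that Rv(x) > 0 for a.e. x ∈ (0, c(v)). Then for any two probability densities u₁, u₂ ∈ L¹((0,∞)) with u₁ ≠ u₂ (as elements of L¹), ‖Ru₁ − Ru₂‖₁ < ‖u₁ − u₂‖₁. In particular, R has at most one invariant probability density (at most one density u* with Ru* = u*). -/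
open MeasureTheory

/-- Lebesgue measure restricted to `(0,∞)`. -/
noncomputable def muPos : Measure ℝ := volume.restrict (Set.Ioi (0 : ℝ))

lemma aux_int_add {μ : Measure ℝ} (f g : Lp ℝ 1 μ) :
    ∫ x, ((f + g : Lp ℝ 1 μ) : ℝ → ℝ) x ∂μ = ∫ x, (f : ℝ → ℝ) x ∂μ + ∫ x, (g : ℝ → ℝ) x ∂μ := by
  rw [← integral_add (L1.integrable_coeFn f) (L1.integrable_coeFn g)]
  exact integral_congr_ae (Lp.coeFn_add f g)

lemma aux_norm {μ : Measure ℝ} (f : Lp ℝ 1 μ) (hf : 0 ≤ f) :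
    ‖f‖ = ∫ x, (f : ℝ → ℝ) x ∂μ := by
  rw [L1.norm_eq_integral_norm]
  refine integral_congr_ae ?_
  filter_upwards [(Lp.coeFn_nonneg f).2 hf] with x hx
  exact Real.norm_of_nonneg hx

lemma aux_norm_add {μ : Measure ℝ} (f g : Lp ℝ 1 μ) (hf : 0 ≤ f) (hg : 0 ≤ g) :
    ‖f + g‖ = ‖f‖ + ‖g‖ := by
  rw [aux_norm _ (add_nonneg hf hg), aux_norm _ hf, aux_norm _ hg, aux_int_add]

lemma aux_strict (f g : Lp ℝ 1 muPos) {c d : ℝ} (hc : 0 < c) (hd : 0 < d)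
    (hf : ∀ᵐ x ∂muPos, x ∈ Set.Ioo (0 : ℝ) c → 0 < (f : ℝ → ℝ) x)
    (hg : ∀ᵐ x ∂muPos, x ∈ Set.Ioo (0 : ℝ) d → 0 < (g : ℝ → ℝ) x) :
    ‖f - g‖ < ‖f‖ + ‖g‖ := by
  by_contra hcon
  have heq : ‖f‖ + ‖g‖ - ‖f - g‖ ≤ 0 := by linarith
  have hfi := (L1.integrable_coeFn f).norm
  have hgi := (L1.integrable_coeFn g).norm
  have hdi := (L1.integrable_coeFn (f - g)).norm
  have hint : ∫ x, (‖(f : ℝ → ℝ) x‖ + ‖(g : ℝ → ℝ) x‖ - ‖((f - g : Lp ℝ 1 muPos) : ℝ → ℝ) x‖) ∂muPos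
      = ‖f‖ + ‖g‖ - ‖f - g‖ := by
    rw [L1.norm_eq_integral_norm, L1.norm_eq_integral_norm, L1.norm_eq_integral_norm,
      ← integral_add hfi hgi]
    exact integral_sub (hfi.add hgi) hdi
  have hnn : 0 ≤ᵐ[muPos] fun x => (‖(f : ℝ → ℝ) x‖ + ‖(g : ℝ → ℝ) x‖ - ‖((f - g : Lp ℝ 1 muPos) : ℝ → ℝ) x‖) := by
    filter_upwards [Lp.coeFn_sub f g] with x hx
    rw [hx]
    simpa using norm_sub_le ((f : ℝ → ℝ) x) ((g : ℝ → ℝ) x)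
  have h0 := (integral_eq_zero_iff_of_nonneg_ae hnn ((hfi.add hgi).sub hdi)).1
    (le_antisymm (hint.trans_le heq) (integral_nonneg_of_ae hnn))
  have hno : ∀ᵐ x ∂muPos, x ∉ Set.Ioo (0 : ℝ) (min c d) := by
    filter_upwards [h0, Lp.coeFn_sub f g, hf, hg] with x hx hs hfx hgx hm
    have h1 := hfx ⟨hm.1, hm.2.trans_le (min_le_left _ _)⟩
    have h2 := hgx ⟨hm.1, hm.2.trans_le (min_le_right _ _)⟩
    rw [hs] at hx
    simp only [Pi.sub_apply, Pi.zero_apply, Real.norm_eq_abs, abs_of_pos h1, abs_of_pos h2] at hx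
    rcases abs_cases ((f : ℝ → ℝ) x - (g : ℝ → ℝ) x) with h | h <;> linarith
  have hz : muPos (Set.Ioo (0 : ℝ) (min c d)) = 0 := by
    exact measure_eq_zero_iff_ae_notMem.2 hno
  rw [muPos, Measure.restrict_apply measurableSet_Ioo,
    Set.inter_eq_left.2 (fun x hx => hx.1), Real.volume_Ioo] at hz
  have := lt_min hc hd
  rw [ENNReal.ofReal_eq_zero] at hz
  linarith

theorem stmt8 (R : Lp ℝ 1 muPos →L[ℝ] Lp ℝ 1 muPos)
    (hpos : ∀ v : Lp ℝ 1 muPos, 0 ≤ v → 0 ≤ R v)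
    (hcontr : ∀ v : Lp ℝ 1 muPos, 0 ≤ v → ‖R v‖ ≤ ‖v‖)
    (hstrict : ∀ v : Lp ℝ 1 muPos, 0 ≤ v → v ≠ 0 →
      ∃ c : ℝ, 0 < c ∧ ∀ᵐ x ∂muPos, x ∈ Set.Ioo (0 : ℝ) c → 0 < (R v : ℝ → ℝ) x) :
    (∀ u₁ u₂ : Lp ℝ 1 muPos, 0 ≤ u₁ → 0 ≤ u₂ →
        (∫ x, (u₁ : ℝ → ℝ) x ∂muPos) = 1 → (∫ x, (u₂ : ℝ → ℝ) x ∂muPos) = 1 →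
        u₁ ≠ u₂ → ‖R u₁ - R u₂‖ < ‖u₁ - u₂‖) ∧
    (∀ u₁ u₂ : Lp ℝ 1 muPos, 0 ≤ u₁ → 0 ≤ u₂ →
        (∫ x, (u₁ : ℝ → ℝ) x ∂muPos) = 1 → (∫ x, (u₂ : ℝ → ℝ) x ∂muPos) = 1 →
        R u₁ = u₁ → R u₂ = u₂ → u₁ = u₂) := by
  have key : ∀ u₁ u₂ : Lp ℝ 1 muPos, 0 ≤ u₁ → 0 ≤ u₂ →
        (∫ x, (u₁ : ℝ → ℝ) x ∂muPos) = 1 → (∫ x, (u₂ : ℝ → ℝ) x ∂muPos) = 1 →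
        u₁ ≠ u₂ → ‖R u₁ - R u₂‖ < ‖u₁ - u₂‖ := by
    intro u₁ u₂ _ _ h1 h2 hne
    set p := (u₁ - u₂)⁺ with hp
    set q := (u₁ - u₂)⁻ with hq
    have hp0 : 0 ≤ p := posPart_nonneg _
    have hq0 : 0 ≤ q := negPart_nonneg _
    have hw : p - q = u₁ - u₂ := posPart_sub_negPart _
    have hsum : ‖u₁ - u₂‖ = ‖p‖ + ‖q‖ := by
      rw [← norm_abs_eq_norm (u₁ - u₂), ← posPart_add_negPart, aux_norm_add _ _ hp0 hq0]
    have hpq : ‖p‖ = ‖q‖ := by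
      have e : p + u₂ = u₁ + q := by
        rw [← sub_eq_sub_iff_add_eq_add]; exact hw
      have e2 := aux_int_add p u₂
      rw [e, aux_int_add, h1, h2, ← aux_norm _ hp0, ← aux_norm _ hq0] at e2
      linarith
    have hwpos : 0 < ‖u₁ - u₂‖ := norm_pos_iff.2 (sub_ne_zero.2 hne)
    have hpn : p ≠ 0 := norm_pos_iff.1 (by linarith)
    have hqn : q ≠ 0 := norm_pos_iff.1 (by linarith)
    obtain ⟨c, hc, hf⟩ := hstrict p hp0 hpn
    obtain ⟨d, hd, hg⟩ := hstrict q hq0 hqn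
    have hs := aux_strict (R p) (R q) hc hd hf hg
    rw [← map_sub, hw, map_sub] at hs
    linarith [hcontr p hp0, hcontr q hq0]
  refine ⟨key, ?_⟩
  intro u₁ u₂ a b h1 h2 e1 e2
  by_contra hne
  have := key u₁ u₂ a b h1 h2 hne
  rw [e1, e2] at this
  exact lt_irrefl _ this
end

section
/- Let γ: (0,∞)→(0,∞) be continuous, φ: (0,∞)→[0,∞) measurable with φ/γ locally integrable on (0,∞), let Q(x) = ∫_x^{x̄} φ(y)/γ(y) dy for a fixed x̄ (with Q finite on (0,∞)), and let h: (0,∞)×(0,∞)→[0,∞) be measurable with ∫₀^∞ h(x,y)dx = 1 for every y>0; set H̄(x,y) = ∫_x^∞ h(z,y)dz. Suppose u*: (0,∞)→[0,∞) is measurable, satisfies γ(x)u*(x) = ∫₀^x H̄(x−y,y) φ(y) u*(y) dy for all x>0, and φu* ∈ L¹((0,∞)). Then the function v*(x) = ∫₀^x h(x−y,y) φ(y) u*(y) dy belongs to L¹((0,∞)) and is a fixed point of the transition operator K, i.e. Kv* = v*, where Kv(x) = ∫₀^x h(x−z,z)(φ(z)/γ(z)) e^{−Q(z)} (∫_z^∞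 v(y) e^{Q(y)} dy) dz. -/
open MeasureTheory

open Filter Topology Set in
theorem aux_exp_ac {P : ℝ → ℝ} {a b : ℝ} (hP : AbsolutelyContinuousOnInterval P a b) :
    AbsolutelyContinuousOnInterval (fun x => Real.exp (P x)) a b := by
  obtain ⟨C, hC⟩ := hP.exists_bound
  have key : ∀ s t : ℝ, s ≤ C → t ≤ C → dist (Real.exp s) (Real.exp t)
      ≤ Real.exp C * dist s t := by
    intro s t hs ht
    rw [dist_eq_norm, dist_eq_norm]
    refine Convex.norm_image_sub_le_of_norm_deriv_le (f := Real.exp) (s := Iic C) (C := Real.exp C)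
      (fun x _ => Real.differentiableAt_exp) ?_ (convex_Iic C) ht hs
    intro x hx
    rw [Real.deriv_exp, Real.norm_eq_abs, Real.abs_exp]
    exact Real.exp_le_exp.mpr hx
  unfold AbsolutelyContinuousOnInterval at *
  have h2 := hP.const_mul (Real.exp C)
  rw [mul_zero] at h2
  refine squeeze_zero' (Eventually.of_forall fun t => Finset.sum_nonneg fun i hi => dist_nonneg)
    ?_ h2
  refine eventually_inf_principal.mpr (Eventually.of_forall fun E hE => ?_)
  rw [Finset.mul_sum]
  refine Finset.sum_le_sum fun i hi => ?_
  have hm := hE.1 i hi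
  exact key _ _ ((le_abs_self _).trans (hC _ hm.1)) ((le_abs_self _).trans (hC _ hm.2))

open Filter Topology Set in
theorem aux_ftc {F q : ℝ → ℝ} {z w G0 P0 : ℝ}
    (hF : IntervalIntegrable F volume z w) (hq : IntervalIntegrable q volume z w) :
    ∫ x in z..w, (F x + q x * (G0 - ∫ t in z..x, F t)) * Real.exp (P0 - ∫ t in z..x, q t)
      = G0 * Real.exp P0 - (G0 - ∫ t in z..w, F t) * Real.exp (P0 - ∫ t in z..w, q t) := by
  have c : ∀ c : ℝ, AbsolutelyContinuousOnInterval (fun _ => c) z w := fun c =>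
    (contDiff_const (𝕜 := ℝ)).contDiffOn.absolutelyContinuousOnInterval
  have hG := (c G0).fun_sub (hF.absolutelyContinuousOnInterval_intervalIntegral (c := z) (by simp))
  have hP := aux_exp_ac
    ((c P0).fun_sub (hq.absolutelyContinuousOnInterval_intervalIntegral (c := z) (by simp)))
  have h1 := hG.integral_deriv_mul_eq_sub hP
  have h2 : ∫ x in z..w, (F x + q x * (G0 - ∫ t in z..x, F t)) * Real.exp (P0 - ∫ t in z..x, q t)
      = - ∫ x in z..w, (deriv (fun x => G0 - ∫ t in z..x, F t) x
          * Real.exp (P0 - ∫ t in z..x, q t) + (G0 - ∫ t in z..x, F t)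
          * deriv (fun x => Real.exp (P0 - ∫ t in z..x, q t)) x) := by
    rw [← intervalIntegral.integral_neg]
    apply intervalIntegral.integral_congr_ae
    filter_upwards [hF.ae_hasDerivAt_integral, hq.ae_hasDerivAt_integral] with x hx1 hx2 hx3
    have hx4 := uIoc_subset_uIcc hx3
    rw [((hx1 hx4 z (by simp)).const_sub G0).deriv, ((hx2 hx4 z (by simp)).const_sub P0).exp.deriv]
    ring
  rw [h2, h1]
  simp

open Filter Topology Set in
theorem aux_limit {v k q g Q : ℝ → ℝ} (hv : IntegrableOn v (Ioi 0)) (hk : IntegrableOn k (Ioi 0))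
    (hq : ∀ x y, 0 < x → 0 < y → IntervalIntegrable q volume x y)
    (hq0 : ∀ x, 0 < x → 0 ≤ q x)
    (hQ : ∀ x y, 0 < x → 0 < y → Q y = Q x - ∫ t in x..y, q t)
    (hg : ∀ x, 0 < x → g x = ∫ t in Ioi x, (v t - k t))
    (hkq : ∀ x, 0 < x → k x = q x * g x) (z : ℝ) (hz : 0 < z) :
    ∫ y in Ioi z, v y * Real.exp (Q y) = g z * Real.exp (Q z) := by
  have hF : IntegrableOn (fun t => v t - k t) (Ioi 0) := hv.sub hk
  have hanti : AntitoneOn Q (Ioi 0) := by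
    intro x hx y hy hxy
    rw [hQ x y hx hy]
    have := intervalIntegral.integral_nonneg (μ := volume) hxy
      (fun t ht => hq0 t (lt_of_lt_of_le hx ht.1))
    linarith
  have hFi : ∀ x y, 0 < x → 0 < y → IntervalIntegrable (fun t => v t - k t) volume x y := by
    intro x y hx hy
    rw [intervalIntegrable_iff]
    refine hF.mono_set ?_
    intro t ht
    exact lt_of_lt_of_le' ht.1 (le_min hx.le hy.le)
  have hgz : ∀ w, z ≤ w → g w = g z - ∫ t in z..w, (v t - k t) := by
    intro w hw
    have hw0 := hz.trans_le hw
    rw [hg w hw0, hg z hz, intervalIntegral.integral_of_le hw, ← Ioc_union_Ioi_eq_Ioi hw,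
      setIntegral_union (by simp) measurableSet_Ioi
        (hF.mono_set (fun t ht => hz.trans ht.1)) (hF.mono_set (fun t ht => hw0.trans ht))]
    ring
  have hfin : ∀ w, z ≤ w → ∫ y in z..w, v y * Real.exp (Q y)
      = g z * Real.exp (Q z) - g w * Real.exp (Q w) := by
    intro w hw
    have hw0 := hz.trans_le hw
    rw [hgz w hw, hQ z w hz hw0, ← aux_ftc (hFi z w hz hw0) (hq z w hz hw0)]
    apply intervalIntegral.integral_congr
    intro x hx
    rw [uIcc_of_le hw] at hx
    have hx0 := hz.trans_le hx.1
    simp only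
    rw [← hgz x hx.1, ← hQ z x hz hx0, ← hkq x hx0]
    ring
  have hint : IntegrableOn (fun y => v y * Real.exp (Q y)) (Ioi z) := by
    have hm : AEMeasurable Q (volume.restrict (Ioi z)) :=
      aemeasurable_restrict_of_antitoneOn measurableSet_Ioi
        (hanti.mono (Ioi_subset_Ioi hz.le))
    refine Integrable.mul_bdd (c := Real.exp (Q z)) (hv.mono_set (Ioi_subset_Ioi hz.le))
      (Real.measurable_exp.comp_aemeasurable hm).aestronglyMeasurable ?_
    filter_upwards [ae_restrict_mem measurableSet_Ioi] with y hy
    rw [Real.norm_eq_abs, Real.abs_exp]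
    exact Real.exp_le_exp.mpr (hanti hz (hz.trans hy) (le_of_lt hy))
  have hl := intervalIntegral_tendsto_integral_Ioi z hint tendsto_id
  have hg0 : Tendsto g atTop (𝓝 0) := by
    have h1 := intervalIntegral_tendsto_integral_Ioi z
      (hF.mono_set (Ioi_subset_Ioi hz.le)) tendsto_id
    have h2 := h1.const_sub (g z)
    rw [← hg z hz, sub_self] at h2
    refine h2.congr' ?_
    filter_upwards [eventually_ge_atTop z] with w hw
    exact (hgz w hw).symm
  have hge : Tendsto (fun w => g w * Real.exp (Q w)) atTop (𝓝 0) := by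
    have h3 := hg0.abs.mul_const (Real.exp (Q z))
    simp only [abs_zero, zero_mul] at h3
    refine squeeze_zero_norm' ?_ h3
    filter_upwards [eventually_ge_atTop z] with w hw
    rw [norm_mul, Real.norm_eq_abs, Real.norm_eq_abs, Real.abs_exp]
    exact mul_le_mul_of_nonneg_left (Real.exp_le_exp.mpr (hanti hz (hz.trans_le hw) hw))
      (abs_nonneg _)
  have hr := hge.const_sub (g z * Real.exp (Q z))
  rw [sub_zero] at hr
  refine tendsto_nhds_unique hl (hr.congr' ?_)
  filter_upwards [eventually_ge_atTop z] with w hw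
  exact (hfin w hw).symm

open Filter Topology Set in
theorem aux_fubini (h : ℝ → ℝ → ℝ) (k vstar : ℝ → ℝ)
    (hhm : Measurable (Function.uncurry h))
    (hh : ∀ x y, 0 < x → 0 < y → 0 ≤ h x y)
    (hh1 : ∀ y, 0 < y → (∫ x in Set.Ioi (0 : ℝ), h x y) = 1)
    (hkm : Measurable k) (hk0 : ∀ x, 0 < x → 0 ≤ k x)
    (hki : IntegrableOn k (Set.Ioi 0))
    (hv : ∀ x, vstar x = ∫ y in Set.Ioc (0 : ℝ) x, h (x - y) y * k y) :
    IntegrableOn vstar (Ioi 0) ∧ ∀ x, 0 < x →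
      ∫ y in Set.Ioc (0 : ℝ) x, (∫ z in Set.Ioi (x - y), h z y) * k y
        = ∫ t in Ioi x, (vstar t - k t) := by
  set K : ℝ → ℝ := (Ioi 0).indicator k with hK
  set H : ℝ → ℝ → ℝ := fun z y => (Ioi 0).indicator (fun z => h z y) z with hH
  set f : ℝ × ℝ → ℝ := fun p => H (p.1 - p.2) p.2 * K p.2 with hf
  have hKm : Measurable K := hkm.indicator measurableSet_Ioi
  have hHm : Measurable (Function.uncurry H) := by
    have : Function.uncurry H = (Prod.fst ⁻¹' Ioi (0:ℝ)).indicator (Function.uncurry h) := by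
      ext ⟨a, b⟩
      simp [hH, Function.uncurry, indicator]
    rw [this]
    exact hhm.indicator (measurable_fst measurableSet_Ioi)
  have hfm : Measurable f :=
    (hHm.comp ((measurable_fst.sub measurable_snd).prodMk measurable_snd)).mul
      (hKm.comp measurable_snd)
  have hf0 : ∀ p, 0 ≤ f p := by
    intro p
    simp only [hf, hH, hK, indicator, mem_Ioi]
    split_ifs with h1 h2
    · exact mul_nonneg (hh _ _ h1 h2) (hk0 _ h2)
    all_goals simp
  have hslice : ∀ a y, ∫ x in Ioi a, f (x, y) = (∫ z in Ioi (a - y), H z y) * K y := by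
    intro a y
    have := (measurePreserving_sub_right volume y).setIntegral_preimage_emb
      (measurableEmbedding_subRight y) (fun z => H z y) (Ioi (a - y))
    simp only [hf]
    rw [integral_mul_const, ← this]
    simp
  have hslice' : ∀ y, ∫ x, f (x, y) = (∫ z, H z y) * K y := by
    intro y
    simp only [hf]
    rw [integral_mul_const, integral_sub_right_eq_self (fun z => H z y) y]
  have hHi : ∀ y, ∫ z, H z y = ∫ z in Ioi 0, h z y := fun y => integral_indicator measurableSet_Ioi
  have hHint : ∀ y, 0 < y → Integrable (fun z => H z y) := by
    intro y hy
    by_contra hc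
    have := integral_undef hc
    rw [hHi, hh1 y hy] at this
    exact one_ne_zero this
  have hKi : Integrable K := hki.integrable_indicator measurableSet_Ioi
  have hfi : Integrable f (volume.prod volume) := by
    rw [integrable_prod_iff' hfm.aestronglyMeasurable]
    constructor
    · refine Eventually.of_forall fun y => ?_
      by_cases hy : 0 < y
      · exact ((hHint y hy).comp_sub_right y).mul_const (K y)
      · have : K y = 0 := by simp [hK, indicator, hy]
        simp [hf, this]
    · refine hKi.congr (Eventually.of_forall fun y => ?_)
      simp only [Real.norm_eq_abs, abs_of_nonneg (hf0 _)]
      rw [hslice']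
      by_cases hy : 0 < y
      · rw [hHi, hh1 y hy, one_mul]
      · have : K y = 0 := by simp [hK, indicator, hy]
        simp [this]
  have hvf : ∀ x, vstar x = ∫ y, f (x, y) := by
    intro x
    rw [hv, ← integral_indicator measurableSet_Ioc]
    apply integral_congr_ae
    have : ∀ᵐ y : ℝ, y ≠ x := by simp [ae_iff]
    filter_upwards [this] with y hy
    by_cases h1 : 0 < y
    · rcases lt_or_gt_of_ne hy with h2 | h2
      · simp [hf, hH, hK, indicator, h1, h2, h2.le]
      · simp [hf, hH, hK, indicator, h1, not_le.mpr h2, not_lt.mpr h2.le]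
    · simp [hf, hH, hK, indicator, h1]
  have hvi : Integrable vstar := by
    rw [show vstar = fun x => ∫ y, f (x, y) from funext hvf]
    exact hfi.integral_prod_left
  refine ⟨hvi.integrableOn, fun x hx => ?_⟩
  have hfr : Integrable (Function.uncurry fun a b => f (a, b))
      ((volume.restrict (Ioi x)).prod volume) := by
    refine Integrable.mono_measure hfi ?_
    have := Measure.prod_restrict (μ := (volume : Measure ℝ)) (ν := (volume : Measure ℝ))
      (Ioi x) univ
    rw [Measure.restrict_univ] at this
    rw [this]
    exact Measure.restrict_le_self
  have hsw := integral_integral_swap hfr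
  have hkx : IntegrableOn k (Ioi x) := hki.mono_set (Ioi_subset_Ioi hx.le)
  rw [integral_sub hvi.integrableOn hkx, funext hvf, hsw]
  have hi2 : Integrable (fun y => ∫ a in Ioi x, f (a, y)) := hfr.integral_prod_right
  simp only [hslice] at hi2 ⊢
  have hz : ∀ y, y ∉ Ioi (0:ℝ) → (∫ z in Ioi (x - y), H z y) * K y = 0 := by
    intro y hy
    rw [hK, indicator_of_notMem hy, mul_zero]
  rw [← setIntegral_eq_integral_of_forall_compl_eq_zero hz, ← Ioc_union_Ioi_eq_Ioi hx.le,
    setIntegral_union (by simp) measurableSet_Ioi hi2.integrableOn hi2.integrableOn]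
  have e1 : ∫ y in Ioi x, (∫ z in Ioi (x - y), H z y) * K y = ∫ y in Ioi x, k y := by
    refine setIntegral_congr_fun measurableSet_Ioi fun y hy => ?_
    have hy0 : 0 < y := hx.trans hy
    have hy' : x < y := hy
    have : ∫ z in Ioi (x - y), H z y = 1 := by
      rw [← hh1 y hy0, ← hHi]
      refine setIntegral_eq_integral_of_forall_compl_eq_zero fun z hz => ?_
      simp only [mem_Ioi, not_lt] at hz
      have : ¬ 0 < z := by linarith
      simp [hH, indicator, this]
    simp only [this, one_mul]
    simp [hK, indicator, hy0]
  have e2 : ∫ y in Ioc 0 x, (∫ z in Ioi (x - y), H z y) * K y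
      = ∫ y in Ioc 0 x, (∫ z in Ioi (x - y), h z y) * k y := by
    refine setIntegral_congr_fun measurableSet_Ioc fun y hy => ?_
    have : ∫ z in Ioi (x - y), H z y = ∫ z in Ioi (x - y), h z y := by
      refine setIntegral_congr_fun measurableSet_Ioi fun z hz => ?_
      have h1 : x - y < z := hz
      have h2 := hy.2
      have : 0 < z := by linarith
      simp [hH, indicator, this]
    simp only [this]
    simp [hK, indicator, hy.1]
  rw [e1, e2]
  ring



theorem stmt9 (γ φ Q : ℝ → ℝ) (xbar : ℝ) (h : ℝ → ℝ → ℝ) (ustar vstar : ℝ → ℝ)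
    (hγc : ContinuousOn γ (Set.Ioi 0)) (hγpos : ∀ x, 0 < x → 0 < γ x)
    (hφm : Measurable φ) (hφ : ∀ x, 0 < x → 0 ≤ φ x)
    (hloc : LocallyIntegrableOn (fun y => φ y / γ y) (Set.Ioi 0))
    (hxbar : 0 < xbar)
    (hQint : ∀ x, 0 < x → IntervalIntegrable (fun y => φ y / γ y) volume x xbar)
    (hQ : ∀ x, 0 < x → Q x = ∫ y in x..xbar, φ y / γ y)
    (hhm : Measurable (Function.uncurry h))
    (hh : ∀ x y, 0 < x → 0 < y → 0 ≤ h x y)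
    (hh1 : ∀ y, 0 < y → (∫ x in Set.Ioi (0 : ℝ), h x y) = 1)
    (hum : Measurable ustar) (hu : ∀ x, 0 < x → 0 ≤ ustar x)
    (hbal : ∀ x, 0 < x → γ x * ustar x
      = ∫ y in Set.Ioc (0 : ℝ) x, (∫ z in Set.Ioi (x - y), h z y) * φ y * ustar y)
    (hφu : IntegrableOn (fun y => φ y * ustar y) (Set.Ioi 0))
    (hv : ∀ x, vstar x = ∫ y in Set.Ioc (0 : ℝ) x, h (x - y) y * φ y * ustar y) :
    IntegrableOn vstar (Set.Ioi 0) ∧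
    ∀ᵐ x ∂(volume.restrict (Set.Ioi (0 : ℝ))),
      (∫ z in Set.Ioc (0 : ℝ) x, h (x - z) z * (φ z / γ z) * Real.exp (-(Q z))
          * ∫ y in Set.Ioi z, vstar y * Real.exp (Q y))
        = vstar x := by
  obtain ⟨hvi, hbal2⟩ := aux_fubini h (fun y => φ y * ustar y) vstar hhm hh hh1 (hφm.mul hum)
    (fun x hx => mul_nonneg (hφ x hx) (hu x hx)) hφu
    (fun x => by rw [hv]; simp only [mul_assoc])
  refine ⟨hvi, ?_⟩
  have hqi : ∀ x y, 0 < x → 0 < y → IntervalIntegrable (fun y => φ y / γ y) volume x y :=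
    fun x y hx hy => (hQint x hx).trans (hQint y hy).symm
  have key := aux_limit (v := vstar) (k := fun y => φ y * ustar y) (q := fun y => φ y / γ y)
    (g := fun x => γ x * ustar x) (Q := Q) hvi hφu hqi
    (fun x hx => div_nonneg (hφ x hx) (hγpos x hx).le)
    (fun x y hx hy => by
      rw [hQ x hx, hQ y hy,
        ← intervalIntegral.integral_add_adjacent_intervals (hqi x y hx hy) (hQint y hy)]
      ring)
    (fun x hx => by rw [← hbal2 x hx, hbal x hx]; simp only [mul_assoc])
    (fun x hx => by have := (hγpos x hx).ne'; field_simp)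
  refine Filter.Eventually.of_forall fun x => ?_
  rw [hv x]
  refine setIntegral_congr_fun measurableSet_Ioc fun z hz => ?_
  have hγz := (hγpos z hz.1).ne'
  simp only [key z hz.1]
  rw [Real.exp_neg]
  have := (Real.exp_pos (Q z)).ne'
  field_simp
end

section
/- Let γ: (0,∞)→(0,∞) be continuous, φ: (0,∞)→[0,∞) measurable with φ/γ locally integrable on (0,∞), and let h: (0,∞)×(0,∞)→[0,∞) be measurable with ∫₀^∞ h(x,y)dx = 1 for every y>0; set H̄(x,y) = ∫_x^∞ h(z,y)dz. Suppose u* ∈ L¹((0,∞)) is nonnegative, satisfies γ(x)u*(x) = ∫₀^x H̄(x−y,y) φ(y) u*(y) dy for all x>0, and φu* ∈ L¹((0,∞)). Then the function x ↦ γ(x)u*(x) is absolutely continuous on compact subintervals of (0,∞), lim_{x→∞} γ(x)u*(x) = 0, lim_{x→0⁺} γ(x)u*(x) = 0, and for almost every x>0, (d/dx)(γ(x)u*(x)) = φ(x)u*(x) − ∫₀^x h(x−y,y) φ(y) u*(y) dy; in other words, u* is a stationary solution of the continuous bursting master equation. -/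
open MeasureTheory Filter

theorem stmt10 (γ φ : ℝ → ℝ) (h : ℝ → ℝ → ℝ) (ustar : ℝ → ℝ)
    (hγc : ContinuousOn γ (Set.Ioi 0)) (hγpos : ∀ x, 0 < x → 0 < γ x)
    (hφm : Measurable φ) (hφ : ∀ x, 0 < x → 0 ≤ φ x)
    (hloc : LocallyIntegrableOn (fun y => φ y / γ y) (Set.Ioi 0))
    (hhm : Measurable (Function.uncurry h))
    (hh : ∀ x y, 0 < x → 0 < y → 0 ≤ h x y)
    (hh1 : ∀ y, 0 < y → (∫ x in Set.Ioi (0 : ℝ), h x y) = 1)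
    (hum : Measurable ustar) (hu : ∀ x, 0 < x → 0 ≤ ustar x)
    (huL1 : IntegrableOn ustar (Set.Ioi 0))
    (hbal : ∀ x, 0 < x → γ x * ustar x
      = ∫ y in Set.Ioc (0 : ℝ) x, (∫ z in Set.Ioi (x - y), h z y) * φ y * ustar y)
    (hφu : IntegrableOn (fun y => φ y * ustar y) (Set.Ioi 0)) :
    (∀ a b : ℝ, 0 < a → a ≤ b →
      γ b * ustar b - γ a * ustar a
        = ∫ x in a..b, (φ x * ustar x
            - ∫ y in Set.Ioc (0 : ℝ) x, h (x - y) y * φ y * ustar y)) ∧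
    Tendsto (fun x => γ x * ustar x) atTop (nhds 0) ∧
    Tendsto (fun x => γ x * ustar x) (nhdsWithin 0 (Set.Ioi 0)) (nhds 0) ∧
    ∀ᵐ x ∂(volume.restrict (Set.Ioi (0 : ℝ))),
      HasDerivAt (fun t => γ t * ustar t)
        (φ x * ustar x - ∫ y in Set.Ioc (0 : ℝ) x, h (x - y) y * φ y * ustar y) x := by
  classical
  set p : ℝ → ℝ → ℝ := fun z y => if 0 < z ∧ 0 < y then h z y else 0 with hp
  set G : ℝ → ℝ := (Set.Ioi (0:ℝ)).indicator (fun y => φ y * ustar y) with hG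
  have hGi : Integrable G := hφu.integrable_indicator measurableSet_Ioi
  have hGm : Measurable G := (hφm.mul hum).indicator measurableSet_Ioi
  have hG0 : ∀ y, 0 ≤ G y := fun y =>
    Set.indicator_nonneg (fun y hy => mul_nonneg (hφ y hy) (hu y hy)) y
  have hGneg : ∀ y, ¬ 0 < y → G y = 0 := fun y hy => by
    simp [hG, Set.indicator, hy]
  have hGpos : ∀ y, 0 < y → G y = φ y * ustar y := fun y hy => by
    simp [hG, Set.indicator, hy]
  have hpm : Measurable (Function.uncurry p) := by
    refine Measurable.ite ?_ hhm measurable_const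
    exact (measurableSet_lt measurable_const measurable_fst).inter
      (measurableSet_lt measurable_const measurable_snd)
  have hp0 : ∀ z y, 0 ≤ p z y := by
    intro z y
    simp only [hp]
    split_ifs with hc
    · exact hh z y hc.1 hc.2
    · exact le_rfl
  have hpind : ∀ y, 0 < y → (fun z => p z y) = (Set.Ioi (0:ℝ)).indicator (fun z => h z y) := by
    intro y hy
    ext z
    simp [hp, hy, Set.indicator]
  have hpi : ∀ y, 0 < y → Integrable (fun z => p z y) := by
    intro y hy
    rw [hpind y hy]
    refine IntegrableOn.integrable_indicator ?_ measurableSet_Ioi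
    by_contra hc
    have := integral_undef hc
    rw [hh1 y hy] at this
    exact one_ne_zero this
  have hp1 : ∀ y, 0 < y → ∫ z, p z y = 1 := by
    intro y hy
    rw [hpind y hy, integral_indicator measurableSet_Ioi, hh1 y hy]
  set k : ℝ → ℝ → ℝ := fun x y => p (x - y) y * G y with hk
  have hkm : Measurable (Function.uncurry k) :=
    (hpm.comp ((measurable_fst.sub measurable_snd).prodMk measurable_snd)).mul
      (hGm.comp measurable_snd)
  have hk0 : ∀ x y, 0 ≤ k x y := fun x y => mul_nonneg (hp0 _ _) (hG0 _)
  have hkint : ∀ y, ∫ x, k x y = G y := by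
    intro y
    by_cases hy : 0 < y
    · simp only [hk]
      rw [integral_mul_const, integral_sub_right_eq_self (fun z => p z y) y, hp1 y hy, one_mul]
    · simp [hk, hGneg y hy]
  have hki1 : ∀ y, Integrable (fun x => k x y) := by
    intro y
    by_cases hy : 0 < y
    · exact ((hpi y hy).comp_sub_right y).mul_const _
    · simp [hk, hGneg y hy]
  have hki : Integrable (Function.uncurry k) (volume.prod volume) := by
    rw [integrable_prod_iff' hkm.aestronglyMeasurable]
    refine ⟨Eventually.of_forall hki1, ?_⟩
    refine hGi.congr (Eventually.of_forall fun y => ?_)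
    simp only [Function.uncurry, Real.norm_of_nonneg (hk0 _ _)]
    exact (hkint y).symm
  set K : ℝ → ℝ := fun x => ∫ y, k x y with hK
  have hKi : Integrable K := hki.integral_prod_left
  have hK1 : ∫ x, K x = ∫ y, G y := by
    simp only [hK]
    rw [integral_integral_swap hki]
    simp only [hkint]
  have hKpos : ∀ x, K x = ∫ y in Set.Ioc (0:ℝ) x, h (x - y) y * φ y * ustar y := by
    intro x
    rw [← integral_indicator measurableSet_Ioc]
    refine integral_congr_ae ?_
    filter_upwards [Measure.ae_ne volume x] with y hy
    by_cases hy0 : 0 < y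
    · rcases lt_or_gt_of_ne hy with hl | hl
      · simp [hk, hp, hy0, hl, hl.le, hGpos y hy0, mul_assoc]
      · simp [hk, hp, hy0, hl, hl.le, hl.not_gt, hl.not_ge]
    · simp [hk, hGneg y hy0, hy0]
  set f : ℝ → ℝ := fun x => G x - K x with hf
  have hfi : Integrable f := hGi.sub hKi
  have hfpos : ∀ x, 0 < x → f x = φ x * ustar x
      - ∫ y in Set.Ioc (0 : ℝ) x, h (x - y) y * φ y * ustar y := by
    intro x hx
    simp only [hf]
    rw [hGpos x hx, hKpos x]
  have hfneg : ∀ x, x ≤ 0 → f x = 0 := by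
    intro x hx
    simp only [hf]
    rw [hGneg x hx.not_gt, hKpos x, Set.Ioc_eq_empty hx.not_gt]
    simp
  have hF0 : ∫ x in Set.Iic (0:ℝ), f x = 0 :=
    setIntegral_eq_zero_of_forall_eq_zero fun x hx => hfneg x hx
  have hmain : ∀ x, 0 < x → γ x * ustar x = ∫ s in Set.Iic x, f s := by
    intro x hx
    have hki' : Integrable (Function.uncurry k) ((volume.restrict (Set.Iic x)).prod volume) :=
      hki.mono_measure (Measure.prod_mono Measure.restrict_le_self le_rfl)
    have hkr : Integrable (fun y => ∫ s in Set.Iic x, k s y) := hki'.integral_prod_right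
    rw [hbal x hx]
    simp only [hf]
    rw [integral_sub hGi.integrableOn hKi.integrableOn]
    simp only [hK]
    rw [integral_integral_swap hki', ← integral_indicator measurableSet_Iic,
      ← integral_sub (hGi.indicator measurableSet_Iic) hkr,
      ← integral_indicator measurableSet_Ioc]
    congr 1
    ext y
    by_cases hy : 0 < y
    · have e1 : ∫ s in Set.Iic x, k s y = (∫ z in Set.Iic (x - y), p z y) * G y := by
        simp only [hk]
        rw [integral_mul_const]
        congr 1
        rw [← integral_indicator measurableSet_Iic, ← integral_indicator measurableSet_Iic,
          ← integral_sub_right_eq_self ((Set.Iic (x - y)).indicator fun z => p z y) y]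
        congr 1
        ext s
        simp [Set.indicator]
      have e2 : (∫ z in Set.Iic (x - y), p z y) + ∫ z in Set.Ioi (x - y), p z y = 1 := by
        rw [← hp1 y hy, intervalIntegral.integral_Iic_add_Ioi (hpi y hy).integrableOn
          (hpi y hy).integrableOn]
      by_cases hyx : y ≤ x
      · have e3 : ∫ z in Set.Ioi (x - y), p z y = ∫ z in Set.Ioi (x - y), h z y := by
          refine setIntegral_congr_fun measurableSet_Ioi fun z hz => ?_
          have : 0 < z := lt_of_le_of_lt (sub_nonneg.2 hyx) hz
          simp [hp, this, hy]
        rw [Set.indicator_of_mem (show y ∈ Set.Ioc 0 x from ⟨hy, hyx⟩),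
          Set.indicator_of_mem (show y ∈ Set.Iic x from hyx), e1, mul_assoc, ← hGpos y hy, ← e3,
          eq_sub_of_add_eq e2]
        ring
      · have e3 : ∫ z in Set.Iic (x - y), p z y = 0 := by
          refine setIntegral_eq_zero_of_forall_eq_zero fun z hz => ?_
          have h1 : z ≤ x - y := hz
          have : ¬ 0 < z := by linarith
          simp [hp, this]
        rw [e1, e3]
        simp [hyx]
    · have : ∀ s, k s y = 0 := fun s => by simp [hk, hGneg y hy]
      simp [this, hy, hGneg y hy, Set.indicator]
  have hmain' : ∀ x, 0 < x → γ x * ustar x = ∫ s in (0:ℝ)..x, f s := by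
    intro x hx
    rw [hmain x hx, ← intervalIntegral.integral_Iic_sub_Iic hfi.integrableOn hfi.integrableOn, hF0,
      sub_zero]
  refine ⟨?_, ?_, ?_, ?_⟩
  · intro a b ha hab
    rw [hmain a ha, hmain b (ha.trans_le hab),
      intervalIntegral.integral_Iic_sub_Iic hfi.integrableOn hfi.integrableOn]
    refine intervalIntegral.integral_congr fun x hx => ?_
    rw [Set.uIcc_of_le hab] at hx
    exact hfpos x (ha.trans_le hx.1)
  · have h0 : ∫ x, f x = 0 := by
      simp only [hf]
      rw [integral_sub hGi hKi, hK1, sub_self]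
    have ht := (aecover_Iic (μ := volume) (tendsto_id (α := ℝ) (x := atTop))).integral_tendsto_of_countably_generated hfi
    rw [h0] at ht
    refine ht.congr' ?_
    filter_upwards [eventually_gt_atTop 0] with x hx
    exact (hmain x hx).symm
  · have ht := (hfi.continuous_primitive 0).tendsto 0
    rw [intervalIntegral.integral_same] at ht
    refine (ht.mono_left nhdsWithin_le_nhds).congr' ?_
    filter_upwards [self_mem_nhdsWithin] with x hx
    exact (hmain' x hx).symm
  · rw [ae_restrict_iff' measurableSet_Ioi]
    filter_upwards [LocallyIntegrable.ae_hasDerivAt_integral hfi.locallyIntegrable] with x hx hx0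
    rw [← hfpos x hx0]
    refine (hx 0).congr_of_eventuallyEq ?_
    filter_upwards [Ioi_mem_nhds hx0] with t ht
    exact hmain' t ht
end

section
/- Let γ: (0,∞)→(0,∞) be continuous, φ: (0,∞)→[0,∞) measurable with φ/γ locally integrable on (0,∞), let Q(x) = ∫_x^{x̄} φ(y)/γ(y) dy be finite on (0,∞), and suppose ∫₀^δ φ(x)/γ(x) dx = +∞ for some δ>0 (equivalently Q(x) → +∞ as x→0⁺). Let b>0 and h(x,y) = (1/b)e^{−x/b}. Then the function v*(x) = e^{−x/b − Q(x)} satisfies Kv* = v* pointwise on (0,∞), where Kv(x) = ∫₀^x (1/b)e^{−(x−z)/b} (φ(z)/γ(z)) e^{−Q(z)} (∫_z^∞ v(y) e^{Q(y)} dy) dz. -/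
open MeasureTheory

theorem ac_exp {f : ℝ → ℝ} {a b : ℝ} (hf : AbsolutelyContinuousOnInterval f a b) :
    AbsolutelyContinuousOnInterval (fun x => Real.exp (f x)) a b := by
  obtain ⟨C, hC⟩ := hf.exists_bound
  have hcd : ContDiffOn ℝ 1 Real.exp (Set.Icc (-C) C) := Real.contDiff_exp.contDiffOn
  obtain ⟨K, hK⟩ := hcd.exists_lipschitzOnWith (by decide) (convex_Icc _ _) isCompact_Icc
  have hmem : ∀ x ∈ Set.uIcc a b, f x ∈ Set.Icc (-C) C := fun x hx => by
    have := hC x hx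
    rw [Real.norm_eq_abs, abs_le] at this
    exact this
  rw [absolutelyContinuousOnInterval_iff] at hf ⊢
  intro ε hε
  obtain ⟨δ, hδ, h⟩ := hf (ε / (K + 1)) (by positivity)
  refine ⟨δ, hδ, fun E hE hEd => ?_⟩
  have h1 := h E hE hEd
  have hE' := hE.1
  calc _ ≤ ∑ i ∈ Finset.range E.1, (K : ℝ) * dist (f (E.2 i).1) (f (E.2 i).2) := by
        apply Finset.sum_le_sum
        intro i hi
        exact hK.dist_le_mul _ (hmem _ (hE' i hi).1) _ (hmem _ (hE' i hi).2)
    _ = K * ∑ i ∈ Finset.range E.1, dist (f (E.2 i).1) (f (E.2 i).2) := by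
        rw [Finset.mul_sum]
    _ ≤ (K + 1) * ∑ i ∈ Finset.range E.1, dist (f (E.2 i).1) (f (E.2 i).2) := by
        have : 0 ≤ ∑ i ∈ Finset.range E.1, dist (f (E.2 i).1) (f (E.2 i).2) :=
          Finset.sum_nonneg fun _ _ => dist_nonneg
        nlinarith
    _ < (K + 1) * (ε / (K + 1)) := by
        have : (0 : ℝ) < K + 1 := by positivity
        gcongr
    _ = ε := by field_simp

theorem ftc_exp {g : ℝ → ℝ} {a x : ℝ} (hg : IntervalIntegrable g volume a x) :
    IntervalIntegrable (fun z => g z * Real.exp (∫ t in a..z, g t)) volume a x ∧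
    ∫ z in a..x, g z * Real.exp (∫ t in a..z, g t) = Real.exp (∫ t in a..x, g t) - 1 := by
  have hac := ac_exp (hg.absolutelyContinuousOnInterval_intervalIntegral (c := a) (by simp))
  have hd : ∀ᵐ z, z ∈ Set.uIoc a x →
      deriv (fun z => Real.exp (∫ t in a..z, g t)) z = g z * Real.exp (∫ t in a..z, g t) := by
    filter_upwards [hg.ae_hasDerivAt_integral] with z hz hzm
    have := (hz (Set.uIoc_subset_uIcc hzm) a (by simp)).exp.deriv
    rw [this, mul_comm]
  constructor
  · refine hac.intervalIntegrable_deriv.congr_ae ?_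
    exact (ae_restrict_iff' measurableSet_uIoc).2 hd
  · rw [← intervalIntegral.integral_congr_ae hd, hac.integral_deriv_eq_sub]
    simp

theorem stmt16 (γ φ Q : ℝ → ℝ) (xbar b : ℝ)
    (hγc : ContinuousOn γ (Set.Ioi 0)) (hγpos : ∀ x, 0 < x → 0 < γ x)
    (hφm : Measurable φ) (hφ : ∀ x, 0 < x → 0 ≤ φ x)
    (hloc : LocallyIntegrableOn (fun y => φ y / γ y) (Set.Ioi 0))
    (hxbar : 0 < xbar)
    (hQint : ∀ x, 0 < x → IntervalIntegrable (fun y => φ y / γ y) volume x xbar)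
    (hQ : ∀ x, 0 < x → Q x = ∫ y in x..xbar, φ y / γ y)
    (hdiv : ∃ δ : ℝ, 0 < δ ∧
      (∫⁻ x in Set.Ioc (0 : ℝ) δ, ENNReal.ofReal (φ x / γ x)) = ⊤)
    (hb : 0 < b) :
    ∀ x, 0 < x →
      (∫ z in Set.Ioc (0 : ℝ) x,
          (1 / b) * Real.exp (-(x - z) / b) * (φ z / γ z) * Real.exp (-(Q z))
            * ∫ y in Set.Ioi z, Real.exp (-(y / b) - Q y) * Real.exp (Q y))
        = Real.exp (-(x / b) - Q x) := by
  intro x hx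
  set g : ℝ → ℝ := fun y => φ y / γ y with hgdef
  have hg0 : ∀ y, 0 < y → 0 ≤ g y := fun y hy => div_nonneg (hφ y hy) (hγpos y hy).le
  have hgi : ∀ a c, 0 < a → 0 < c → IntervalIntegrable g volume a c := fun a c ha hc =>
    (hQint a ha).trans (hQint c hc).symm
  have hQd : ∀ a c, 0 < a → 0 < c → ∫ t in a..c, g t = Q a - Q c := by
    intro a c ha hc
    rw [hQ a ha, hQ c hc, eq_sub_iff_add_eq]
    exact intervalIntegral.integral_add_adjacent_intervals (hgi a c ha hc) (hQint c hc)
  -- inner integral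
  have hinner : ∀ z : ℝ, ∫ y in Set.Ioi z, Real.exp (-(y / b) - Q y) * Real.exp (Q y)
      = b * Real.exp (-(z / b)) := by
    intro z
    have h1 : ∀ y : ℝ, Real.exp (-(y / b) - Q y) * Real.exp (Q y) = Real.exp ((-1 / b) * y) := by
      intro y
      rw [← Real.exp_add]; congr 1; ring
    simp_rw [h1]
    rw [integral_exp_mul_Ioi (by rw [neg_div]; simpa using hb)]
    have : -1 / b * z = -(z / b) := by ring
    rw [this]
    field_simp
  have hI : ∀ z : ℝ, (1 / b) * Real.exp (-(x - z) / b) * (φ z / γ z) * Real.exp (-(Q z))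
            * ∫ y in Set.Ioi z, Real.exp (-(y / b) - Q y) * Real.exp (Q y)
      = Real.exp (-(x / b)) * (g z * Real.exp (-(Q z))) := by
    intro z
    rw [hinner]
    have : Real.exp (-(x / b)) = Real.exp (-(x - z) / b) * Real.exp (-(z / b)) := by
      rw [← Real.exp_add]; congr 1; ring
    rw [this]
    simp only [hgdef]
    field_simp
  simp_rw [hI]
  rw [integral_const_mul, sub_eq_add_neg, Real.exp_add]
  congr 1
  -- main claim on [a,x]
  have hfin : ∀ a, 0 < a → a ≤ x →
      IntervalIntegrable (fun z => g z * Real.exp (-(Q z))) volume a x ∧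
      ∫ z in a..x, g z * Real.exp (-(Q z)) = Real.exp (-(Q x)) - Real.exp (-(Q a)) := by
    intro a ha hax
    obtain ⟨h1, h2⟩ := ftc_exp (hgi a x ha hx)
    have hEq : ∀ z ∈ Set.uIcc a x, Real.exp (-(Q a)) * (g z * Real.exp (∫ t in a..z, g t))
        = g z * Real.exp (-(Q z)) := by
      intro z hz
      rw [Set.uIcc_of_le hax] at hz
      rw [hQd a z ha (ha.trans_le hz.1), mul_left_comm, ← Real.exp_add]
      congr 2; ring
    constructor
    · refine (h1.const_mul (Real.exp (-(Q a)))).congr ?_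
      intro z hz
      exact hEq z (Set.uIoc_subset_uIcc hz)
    · rw [← intervalIntegral.integral_congr hEq, intervalIntegral.integral_const_mul, h2,
        hQd a x ha hx, mul_sub, ← Real.exp_add, mul_one]
      congr 2; ring
  let a : ℕ → ℝ := fun n => x / (n + 1)
  have ha0 : ∀ n, 0 < a n := fun n => by positivity
  have hax : ∀ n, a n ≤ x := fun n => by
    apply div_le_self hx.le
    have : (0 : ℝ) ≤ n := n.cast_nonneg
    linarith
  have hat : Filter.Tendsto a Filter.atTop (nhds 0) := by
    have := (tendsto_one_div_add_atTop_nhds_zero_nat (𝕜 := ℝ)).const_mul x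
    simpa [a, div_eq_mul_inv] using this
  have hcov : AECover (volume.restrict (Set.Ioc 0 x)) Filter.atTop
      (fun n => Set.Ioc (a n) x) := aecover_Ioc_of_Ioc hat tendsto_const_nhds
  have hsub : ∀ n, Set.Ioc (a n) x ∩ Set.Ioc 0 x = Set.Ioc (a n) x := fun n =>
    Set.inter_eq_left.2 (Set.Ioc_subset_Ioc_left (ha0 n).le)
  have hQtop : Filter.Tendsto (fun n => Q (a n)) Filter.atTop Filter.atTop := by
    have htop : (∫⁻ y in Set.Ioc (0 : ℝ) x, ENNReal.ofReal (g y)) = ⊤ := by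
      obtain ⟨δ, hδ, h⟩ := hdiv
      rcases le_total δ x with hle | hle
      · exact top_le_iff.1 (h ▸ lintegral_mono_set (Set.Ioc_subset_Ioc_right hle))
      · by_contra hne
        have h2 : (∫⁻ y in Set.Ioc x δ, ENNReal.ofReal (g y)) ≠ ⊤ :=
          ((hgi x δ hx hδ).1.lintegral_lt_top).ne
        have h3 := lintegral_union_le (μ := volume) (fun y => ENNReal.ofReal (g y))
          (Set.Ioc 0 x) (Set.Ioc x δ)
        rw [Set.Ioc_union_Ioc_eq_Ioc hx.le hle, h] at h3
        exact (ENNReal.add_ne_top.2 ⟨hne, h2⟩) (top_le_iff.1 h3)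
    have hm : AEMeasurable (fun y => ENNReal.ofReal (g y)) (volume.restrict (Set.Ioc 0 x)) := by
      have h1 : AEStronglyMeasurable g (volume.restrict (Set.Ioi 0)) := hloc.aestronglyMeasurable
      exact (h1.aemeasurable.mono_measure
        (Measure.restrict_mono Set.Ioc_subset_Ioi_self le_rfl)).ennreal_ofReal
    have ht := hcov.lintegral_tendsto_of_countably_generated hm
    rw [htop] at ht
    have hrw : ∀ n, (∫⁻ y in Set.Ioc (a n) x, ENNReal.ofReal (g y)
        ∂(volume.restrict (Set.Ioc 0 x))) = ENNReal.ofReal (Q (a n) - Q x) := by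
      intro n
      rw [Measure.restrict_restrict measurableSet_Ioc, hsub, ← hQd _ _ (ha0 n) hx,
        intervalIntegral.integral_of_le (hax n), ofReal_integral_eq_lintegral_ofReal]
      · exact (hgi _ _ (ha0 n) hx).1
      · filter_upwards [ae_restrict_mem measurableSet_Ioc] with y hy
        exact hg0 y ((ha0 n).trans hy.1)
    simp_rw [hrw] at ht
    have := ENNReal.tendsto_ofReal_nhds_top.1 ht
    have h5 := Filter.tendsto_atTop_add_const_right _ (Q x) this
    simpa using h5
  have hint : IntegrableOn (fun z => g z * Real.exp (-(Q z))) (Set.Ioc 0 x) := by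
    refine integrableOn_Ioc_of_intervalIntegral_norm_bounded_left (a := a)
      (I := Real.exp (-(Q x))) (l := Filter.atTop)
      (fun n => (hfin _ (ha0 n) (hax n)).1.1) hat (Filter.Eventually.of_forall fun n => ?_)
    have : ∫ z in Set.Ioc (a n) x, ‖g z * Real.exp (-(Q z))‖
        = ∫ z in Set.Ioc (a n) x, g z * Real.exp (-(Q z)) := by
      refine setIntegral_congr_fun measurableSet_Ioc fun y hy => ?_
      exact Real.norm_of_nonneg (mul_nonneg (hg0 y ((ha0 n).trans hy.1)) (Real.exp_pos _).le)
    rw [this, ← intervalIntegral.integral_of_le (hax n), (hfin _ (ha0 n) (hax n)).2]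
    linarith [Real.exp_pos (-(Q (a n)))]
  have ht1 := hcov.integral_tendsto_of_countably_generated hint
  have hrw : ∀ n, (∫ z in Set.Ioc (a n) x, g z * Real.exp (-(Q z))
      ∂(volume.restrict (Set.Ioc 0 x))) = Real.exp (-(Q x)) - Real.exp (-(Q (a n))) := by
    intro n
    rw [Measure.restrict_restrict measurableSet_Ioc, hsub,
      ← intervalIntegral.integral_of_le (hax n), (hfin _ (ha0 n) (hax n)).2]
  simp_rw [hrw] at ht1
  have ht2 : Filter.Tendsto (fun n => Real.exp (-(Q x)) - Real.exp (-(Q (a n)))) Filter.atTop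
      (nhds (Real.exp (-(Q x)) - 0)) :=
    tendsto_const_nhds.sub (Real.tendsto_exp_neg_atTop_nhds_zero.comp hQtop)
  rw [sub_zero] at ht2
  exact tendsto_nhds_unique ht1 ht2
end

section
/- Let γ>0, b>0, λ_0>0, λ≥0 with 1/b > λ/γ, and set φ(x) = λ_0 + λx, γ(x) = γx, h(x,y) = (1/b)e^{−x/b}. Then the gamma density u*(x) = (1/Γ(λ_0/γ)) (1/b − λ/γ)^{λ_0/γ} x^{λ_0/γ − 1} e^{−(1/b − λ/γ)x} satisfies ∫₀^∞ u*(x)dx = 1 and the stationary balance equation γx·u*(x) = ∫₀^x e^{−(x−y)/b} (λ_0 + λy) u*(y) dy for all x>0. -/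
open MeasureTheory

/-- The gamma density `u*(x) = (1/Γ(λ₀/γ)) (1/b − λ/γ)^{λ₀/γ} x^{λ₀/γ−1}
e^{−(1/b−λ/γ)x}`. -/
noncomputable def gammaDensity (γ b lam0 lam : ℝ) (x : ℝ) : ℝ :=
  (1 / Real.Gamma (lam0 / γ)) * (1 / b - lam / γ) ^ (lam0 / γ)
    * x ^ (lam0 / γ - 1) * Real.exp (-(1 / b - lam / γ) * x)

theorem stmt18 (γ b lam0 lam : ℝ)
    (hγ : 0 < γ) (hb : 0 < b) (hlam0 : 0 < lam0) (hlam : 0 ≤ lam)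
    (hcond : lam / γ < 1 / b) :
    (∫ x in Set.Ioi (0 : ℝ), gammaDensity γ b lam0 lam x) = 1 ∧
    ∀ x, 0 < x →
      γ * x * gammaDensity γ b lam0 lam x
        = ∫ y in Set.Ioc (0 : ℝ) x,
            Real.exp (-(x - y) / b) * (lam0 + lam * y) * gammaDensity γ b lam0 lam y := by
  have hs : 0 < lam0 / γ := div_pos hlam0 hγ
  have hr : 0 < 1 / b - lam / γ := sub_pos.mpr hcond
  constructor
  · have h := Real.integral_rpow_mul_exp_neg_mul_Ioi hs hr
    have hG := Real.Gamma_pos_of_pos hs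
    have hp : 0 < (1 / b - lam / γ) ^ (lam0 / γ) := Real.rpow_pos_of_pos hr _
    have e : ∀ x, gammaDensity γ b lam0 lam x =
        ((1 / Real.Gamma (lam0 / γ)) * (1 / b - lam / γ) ^ (lam0 / γ)) *
          (x ^ (lam0 / γ - 1) * Real.exp (-((1 / b - lam / γ) * x))) := by
      intro x
      rw [gammaDensity, neg_mul]
      ring
    simp_rw [e]
    rw [integral_const_mul, h, Real.div_rpow zero_le_one hr.le, Real.one_rpow]
    generalize (1 / b - lam / γ) ^ (lam0 / γ) = P at hp
    generalize Real.Gamma (lam0 / γ) = G at hG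
    field_simp
  · intro x hx
    obtain ⟨C, hC⟩ : ∃ C, C = (1 / Real.Gamma (lam0 / γ)) * (1 / b - lam / γ) ^ (lam0 / γ) :=
      ⟨_, rfl⟩
    have e : ∀ y, Real.exp (-(x - y) / b) * (lam0 + lam * y) * gammaDensity γ b lam0 lam y =
        y ^ (lam0 / γ - 1) *
          (C * Real.exp (-x / b) * (lam0 + lam * y) * Real.exp (lam / γ * y)) := by
      intro y
      have h1 : Real.exp (-(x - y) / b) * Real.exp (-(1 / b - lam / γ) * y) =
          Real.exp (-x / b) * Real.exp (lam / γ * y) := by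
        rw [← Real.exp_add, ← Real.exp_add]
        congr 1
        ring
      rw [gammaDensity, ← hC]
      linear_combination (lam0 + lam * y) * C * y ^ (lam0 / γ - 1) * h1
    simp_rw [e]
    rw [← intervalIntegral.integral_of_le hx.le]
    rw [intervalIntegral.integral_eq_sub_of_hasDerivAt_of_le
      (f := fun y => C * Real.exp (-x / b) * γ * (y ^ (lam0 / γ) * Real.exp (lam / γ * y))) hx.le]
    · have h1 : Real.exp (-(1 / b - lam / γ) * x) =
          Real.exp (-x / b) * Real.exp (lam / γ * x) := by
        rw [← Real.exp_add]
        congr 1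
        ring
      have h2 : x ^ (lam0 / γ) = x ^ (lam0 / γ - 1) * x := by
        rw [Real.rpow_sub_one hx.ne']
        field_simp
      rw [gammaDensity, ← hC, h1, h2, Real.zero_rpow hs.ne']
      ring
    · apply Continuous.continuousOn
      have := Real.continuous_rpow_const (q := lam0 / γ) hs.le
      fun_prop
    · intro y hy
      have hy0 : 0 < y := hy.1
      have h2 : y ^ (lam0 / γ) = y ^ (lam0 / γ - 1) * y := by
        rw [Real.rpow_sub_one hy0.ne']
        field_simp
      have d1 := Real.hasDerivAt_rpow_const (x := y) (p := lam0 / γ) (Or.inl hy0.ne')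
      have d2 := ((hasDerivAt_id y).const_mul (lam / γ)).exp
      have d := (d1.mul d2).const_mul (C * Real.exp (-x / b) * γ)
      refine d.congr_deriv ?_
      simp only [id, h2]
      field_simp
    · apply IntervalIntegrable.mul_continuousOn
      · exact intervalIntegral.intervalIntegrable_rpow' (by linarith)
      · fun_prop
end
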